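/- arXiv:2304.14195 — 8 statements merged into one kernel-verified Lean document; each statement's English description precedes it below -/
import Mathlib

section
/- Let N ≤ H be subgroups of a finite group G with N normal in G. If H is strongly 4-quasinormal in G, then H/N is strongly 4-quasinormal in G/N. -/
open scoped Pointwise

/-- `H` is 4-permutable with `K` in `G`: `⟨H, K⟩ = HKHK` as sets. -/
def Perm4 {G : Type*} [Group G] (H K : Subgroup G) : Prop :=
  ((H ⊔ K : Subgroup G) : Set G) = (H : Set G) * (K : Set G) * (H : Set G) * (K : Set G)

/-- `H` is strongly 4-quasinormal in `G`: `H` is 4-permutable with every subgroup of `G`. -/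
def Sqn4 {G : Type*} [Group G] (H : Subgroup G) : Prop :=
  ∀ K : Subgroup G, Perm4 H K

/-- `H` is strongly 4-quasinormal in the subgroup `K` of `G`:
`H` is 4-permutable with every subgroup contained in `K`. -/
def Sqn4In {G : Type*} [Group G] (H K : Subgroup G) : Prop :=
  ∀ L : Subgroup G, L ≤ K → Perm4 H L

/-- `G` is an `Sq4T`-group: strong 4-quasinormality is transitive in `G`. -/
def IsSq4T (G : Type*) [Group G] : Prop :=
  ∀ H K : Subgroup G, H ≤ K → Sqn4In H K → Sqn4 K → Sqn4 H


/-- If `N ≤ H` are subgroups of a finite group `G` with `N` normal in `G` and `H`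
strongly 4-quasinormal in `G`, then `H/N` is strongly 4-quasinormal in `G/N`. -/
theorem sqn4_quotient {G : Type*} [Group G] [Finite G] (N H : Subgroup G) [N.Normal]
    (hNH : N ≤ H) (h : Sqn4 H) : Sqn4 (H.map (QuotientGroup.mk' N)) := by
  intro K
  have hL := congrArg (Set.image (QuotientGroup.mk' N)) (h (K.comap (QuotientGroup.mk' N)))
  simpa only [Perm4, Set.image_mul, ← Subgroup.coe_map, Subgroup.map_sup,
    Subgroup.map_comap_eq_self_of_surjective (QuotientGroup.mk'_surjective N)] using hL
end

section
/- In the symmetric group S₃, the subgroup H = ⟨(1 2)⟩ is strongly 4-quasinormal in S₃ but H is not permutable in S₃ (indeed H⟨(1 3)⟩ ≠ ⟨(1 3)⟩H). -/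
open scoped Pointwise

/-- A subgroup generated by an involution consists of the identity and that involution. -/
theorem mem_closure_singleton_of_mul_self_eq_one {G : Type*} [Group G] {s : G} (hs : s * s = 1)
    {x : G} : x ∈ Subgroup.closure {s} ↔ x = 1 ∨ x = s := by
  rw [Subgroup.mem_closure_singleton]
  constructor
  · rintro ⟨n, rfl⟩
    rcases Int.even_or_odd' n with ⟨m, rfl | rfl⟩
    · left
      rw [zpow_mul, zpow_two, hs, one_zpow]
    · right
      rw [zpow_add, zpow_mul, zpow_two, hs, one_zpow, one_mul, zpow_one]
  · rintro (rfl | rfl)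
    · exact ⟨0, zpow_zero _⟩
    · exact ⟨1, zpow_one _⟩

theorem mem_mul_mul_mul_iff {G : Type*} [Group G] {H K : Subgroup G} {x : G} :
    x ∈ (H : Set G) * (K : Set G) * (H : Set G) * (K : Set G) ↔
      ∃ h ∈ H, ∃ k ∈ K, ∃ h' ∈ H, ∃ k' ∈ K, h * k * h' * k' = x := by
  simp only [Set.mem_mul, SetLike.mem_coe]
  constructor
  · rintro ⟨_, ⟨_, ⟨h, hh, k, hk, rfl⟩, h', hh', rfl⟩, k', hk', rfl⟩
    exact ⟨h, hh, k, hk, h', hh', k', hk', rfl⟩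
  · rintro ⟨h, hh, k, hk, h', hh', k', hk', rfl⟩
    exact ⟨_, ⟨_, ⟨h, hh, k, hk, rfl⟩, h', hh', rfl⟩, k', hk', rfl⟩

/-- If `KHKH ⊆ HKHK`, then `H` is 4-permutable with `K`. -/
theorem Perm4.of_forall_mem {G : Type*} [Group G] {H K : Subgroup G}
    (hHK : ∀ k ∈ K, ∀ h ∈ H, ∀ k' ∈ K, ∀ h' ∈ H,
      k * h * k' * h' ∈ (H : Set G) * (K : Set G) * (H : Set G) * (K : Set G)) :
    Perm4 H K := by
  have right_H : ∀ x ∈ (H : Set G) * (K : Set G) * (H : Set G) * (K : Set G), ∀ y ∈ H,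
      x * y ∈ (H : Set G) * (K : Set G) * (H : Set G) * (K : Set G) := by
    intro x hx y hy
    obtain ⟨h, hh, k, hk, h', hh', k', hk', rfl⟩ := mem_mul_mul_mul_iff.1 hx
    obtain ⟨a, ha, b, hb, a', ha', b', hb', e⟩ :=
      mem_mul_mul_mul_iff.1 (hHK k hk h' hh' k' hk' y hy)
    refine mem_mul_mul_mul_iff.2
      ⟨h * a, H.mul_mem hh ha, b, hb, a', ha', b', hb', ?_⟩
    simpa only [mul_assoc] using congrArg (h * ·) e
  have right_K : ∀ x ∈ (H : Set G) * (K : Set G) * (H : Set G) * (K : Set G), ∀ y ∈ K,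
      x * y ∈ (H : Set G) * (K : Set G) * (H : Set G) * (K : Set G) := by
    intro x hx y hy
    obtain ⟨h, hh, k, hk, h', hh', k', hk', rfl⟩ := mem_mul_mul_mul_iff.1 hx
    exact mem_mul_mul_mul_iff.2
      ⟨h, hh, k, hk, h', hh', k' * y, K.mul_mem hk' hy, by simp only [mul_assoc]⟩
  apply Set.Subset.antisymm
  · intro x hx
    rw [SetLike.mem_coe, Subgroup.sup_eq_closure] at hx
    induction hx using Subgroup.closure_induction_right with
    | one =>
      exact mem_mul_mul_mul_iff.2
        ⟨1, H.one_mem, 1, K.one_mem, 1, H.one_mem, 1, K.one_mem, by simp⟩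
    | mul_right x _ y hy ih => exact hy.elim (right_H x ih y) (right_K x ih y)
    | mul_inv_cancel x _ y hy ih =>
      exact hy.elim (fun h => right_H x ih y⁻¹ (H.inv_mem h))
        (fun h => right_K x ih y⁻¹ (K.inv_mem h))
  · intro x hx
    obtain ⟨h, hh, k, hk, h', hh', k', hk', rfl⟩ := mem_mul_mul_mul_iff.1 hx
    have hH : H ≤ H ⊔ K := le_sup_left
    have hK : K ≤ H ⊔ K := le_sup_right
    exact mul_mem (mul_mem (mul_mem (hH hh) (hK hk)) (hH hh')) (hK hk')

theorem mem_closure_swap_zero_one {x : Equiv.Perm (Fin 3)} :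
    x ∈ Subgroup.closure {Equiv.swap (0 : Fin 3) 1} ↔ x = 1 ∨ x = Equiv.swap 0 1 :=
  mem_closure_singleton_of_mul_self_eq_one (Equiv.swap_mul_self 0 1)

theorem mem_closure_swap_zero_two {x : Equiv.Perm (Fin 3)} :
    x ∈ Subgroup.closure {Equiv.swap (0 : Fin 3) 2} ↔ x = 1 ∨ x = Equiv.swap 0 2 :=
  mem_closure_singleton_of_mul_self_eq_one (Equiv.swap_mul_self 0 2)

set_option maxRecDepth 10000 in
theorem exists_rewrite_mul_swap_mul_swap (a b : Equiv.Perm (Fin 3)) :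
    ∃ h ∈ [1, Equiv.swap 0 1], ∃ k ∈ [1, a, b, a * b], ∃ h' ∈ [1, Equiv.swap 0 1],
      ∃ k' ∈ [1, a, b, a * b], h * k * h' * k' = a * Equiv.swap 0 1 * b * Equiv.swap 0 1 := by
  revert a b
  decide

theorem sqn4_closure_swap_zero_one : Sqn4 (Subgroup.closure {Equiv.swap (0 : Fin 3) 1}) := by
  intro K
  apply Perm4.of_forall_mem
  intro a ha h hh b hb h' hh'
  have mem_H : ∀ x ∈ [1, Equiv.swap 0 1],
      x ∈ Subgroup.closure {Equiv.swap (0 : Fin 3) 1} := by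
    intro x hx
    simpa [mem_closure_swap_zero_one] using hx
  have mem_K : ∀ x ∈ [1, a, b, a * b], x ∈ K := by
    simp [ha, hb, K.one_mem, K.mul_mem ha hb]
  rw [mem_mul_mul_mul_iff]
  rcases mem_closure_swap_zero_one.1 hh' with rfl | rfl
  · exact ⟨1, one_mem _, a, ha, h, hh, b, hb, by simp⟩
  rcases mem_closure_swap_zero_one.1 hh with rfl | rfl
  · exact ⟨1, one_mem _, a * b, K.mul_mem ha hb, _, hh', 1, one_mem _, by simp⟩
  obtain ⟨x, hx, y, hy, x', hx', y', hy', e⟩ := exists_rewrite_mul_swap_mul_swap a b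
  exact ⟨x, mem_H x hx, y, mem_K y hy, x', mem_H x' hx', y', mem_K y' hy', e⟩

theorem closure_swap_mul_closure_swap_ne :
    (Subgroup.closure {Equiv.swap (0 : Fin 3) 1} : Set (Equiv.Perm (Fin 3))) *
        (Subgroup.closure {Equiv.swap (0 : Fin 3) 2} : Set (Equiv.Perm (Fin 3))) ≠
      (Subgroup.closure {Equiv.swap (0 : Fin 3) 2} : Set (Equiv.Perm (Fin 3))) *
        (Subgroup.closure {Equiv.swap (0 : Fin 3) 1} : Set (Equiv.Perm (Fin 3))) := by
  intro e
  have hmem := Set.mul_mem_mul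
    (SetLike.mem_coe.2 (mem_closure_swap_zero_one.2 (Or.inr rfl)))
    (SetLike.mem_coe.2 (mem_closure_swap_zero_two.2 (Or.inr rfl)))
  rw [e] at hmem
  obtain ⟨x, hx, y, hy, hxy⟩ := hmem
  rcases mem_closure_swap_zero_two.1 hx with rfl | rfl <;>
    rcases mem_closure_swap_zero_one.1 hy with rfl | rfl <;>
    exact absurd hxy (by decide)

/-- In `S₃`, the subgroup `H = ⟨(1 2)⟩` is strongly 4-quasinormal but not permutable;
indeed `H⟨(1 3)⟩ ≠ ⟨(1 3)⟩H`. -/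
theorem sqn4_not_permutable_S3 :
    Sqn4 (Subgroup.closure {Equiv.swap (0 : Fin 3) 1}) ∧
    ¬ (∀ K : Subgroup (Equiv.Perm (Fin 3)),
        (Subgroup.closure {Equiv.swap (0 : Fin 3) 1} : Set (Equiv.Perm (Fin 3))) *
            (K : Set (Equiv.Perm (Fin 3))) =
          (K : Set (Equiv.Perm (Fin 3))) *
            (Subgroup.closure {Equiv.swap (0 : Fin 3) 1} : Set (Equiv.Perm (Fin 3)))) ∧
    (Subgroup.closure {Equiv.swap (0 : Fin 3) 1} : Set (Equiv.Perm (Fin 3))) *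
        (Subgroup.closure {Equiv.swap (0 : Fin 3) 2} : Set (Equiv.Perm (Fin 3))) ≠
      (Subgroup.closure {Equiv.swap (0 : Fin 3) 2} : Set (Equiv.Perm (Fin 3))) *
        (Subgroup.closure {Equiv.swap (0 : Fin 3) 1} : Set (Equiv.Perm (Fin 3))) := by
  exact ⟨sqn4_closure_swap_zero_one, fun h => closure_swap_mul_closure_swap_ne (h _),
    closure_swap_mul_closure_swap_ne⟩
end

section
/- In the dihedral group D₁₂ = ⟨r, s : r⁶ = s² = 1, s r s = r⁻¹⟩ of order 12, the subgroup K = ⟨s⟩ is not 4-permutable with the subgroup M = ⟨sr⟩; in particular, K is not strongly 4-quasinormal in D₁₂. -/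
open scoped Pointwise

theorem DihedralGroup.mem_closure_singleton_sr {n : ℕ} {i : ZMod n} {x : DihedralGroup n} :
    x ∈ Subgroup.closure {DihedralGroup.sr i} ↔ x = 1 ∨ x = DihedralGroup.sr i := by
  refine ⟨fun hx => ?_, ?_⟩
  · induction hx using Subgroup.closure_induction with
    | mem x hx => exact Or.inr hx
    | one => exact Or.inl rfl
    | mul x y _ _ hx hy =>
      rcases hx with rfl | rfl <;> rcases hy with rfl | rfl <;> simp
    | inv x _ hx => rcases hx with rfl | rfl <;> simp
  · rintro (rfl | rfl)
    · exact one_mem _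
    · exact Subgroup.mem_closure_singleton_self _

theorem not_perm4_closure_sr_zero_closure_sr_one :
    ¬ Perm4 (Subgroup.closure {DihedralGroup.sr (0 : ZMod 6)})
        (Subgroup.closure {DihedralGroup.sr (1 : ZMod 6)}) := by
  intro h
  let H := Subgroup.closure {DihedralGroup.sr (0 : ZMod 6)}
  let K := Subgroup.closure {DihedralGroup.sr (1 : ZMod 6)}
  have hs : DihedralGroup.sr (0 : ZMod 6) ∈ H ⊔ K :=
    le_sup_left (a := H) (Subgroup.mem_closure_singleton_self _)
  have ht : DihedralGroup.sr (1 : ZMod 6) ∈ H ⊔ K :=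
    le_sup_right (b := K) (Subgroup.mem_closure_singleton_self _)
  have hr : (DihedralGroup.sr (0 : ZMod 6) * DihedralGroup.sr 1) ^ 3 ∈
      ((H ⊔ K : Subgroup _) : Set (DihedralGroup 6)) :=
    pow_mem (mul_mem hs ht) 3
  rw [show ((H ⊔ K : Subgroup _) : Set (DihedralGroup 6)) = _ from h] at hr
  obtain ⟨_, ⟨_, ⟨a, ha, b, hb, rfl⟩, c, hc, rfl⟩, d, hd, habcd⟩ := hr
  rw [SetLike.mem_coe, DihedralGroup.mem_closure_singleton_sr] at ha hb hc hd
  rcases ha with rfl | rfl <;> rcases hb with rfl | rfl <;> rcases hc with rfl | rfl <;>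
    rcases hd with rfl | rfl <;> revert habcd <;> decide

/-- In the dihedral group of order 12, the subgroup `K = ⟨s⟩` is not 4-permutable with
`M = ⟨sr⟩`; in particular, `K` is not strongly 4-quasinormal. -/
theorem not_sqn4_in_D12 :
    ¬ Perm4 (Subgroup.closure {DihedralGroup.sr (0 : ZMod 6)})
        (Subgroup.closure {DihedralGroup.sr (1 : ZMod 6)}) ∧
    ¬ Sqn4 (Subgroup.closure {DihedralGroup.sr (0 : ZMod 6)}) := by
  exact ⟨not_perm4_closure_sr_zero_closure_sr_one,
    fun h => not_perm4_closure_sr_zero_closure_sr_one (h _)⟩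
end

section
/- The dihedral group D₁₂ of order 12 is not an Sq4T-group: the subgroup ⟨s⟩ is strongly 4-quasinormal in H = ⟨r², s⟩ and H is strongly 4-quasinormal in D₁₂, but ⟨s⟩ is not strongly 4-quasinormal in D₁₂. -/
open scoped Pointwise

theorem perm4_of_forall_mem {G : Type*} [Group G] {H K : Subgroup G}
    (h : ∀ x ∈ H ⊔ K, ∃ a ∈ H, ∃ b ∈ K, ∃ c ∈ H, ∃ d ∈ K, a * b * c * d = x) : Perm4 H K := by
  apply Set.Subset.antisymm
  · intro x hx
    obtain ⟨a, ha, b, hb, c, hc, d, hd, rfl⟩ := h x hx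
    exact Set.mul_mem_mul (Set.mul_mem_mul (Set.mul_mem_mul ha hb) hc) hd
  · rintro _ ⟨_, ⟨_, ⟨a, ha, b, hb, rfl⟩, c, hc, rfl⟩, d, hd, rfl⟩
    have hH : H ≤ H ⊔ K := le_sup_left
    have hK : K ≤ H ⊔ K := le_sup_right
    exact mul_mem (mul_mem (mul_mem (hH ha) (hK hb)) (hH hc)) (hK hd)

theorem sqn4_of_normal {G : Type*} [Group G] (H : Subgroup G) [H.Normal] : Sqn4 H := by
  refine fun K => perm4_of_forall_mem fun x hx => ?_
  obtain ⟨a, ha, b, hb, rfl⟩ := Subgroup.mem_sup_of_normal_left.1 hx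
  exact ⟨a, ha, b, hb, 1, H.one_mem, 1, K.one_mem, by simp⟩

namespace DihedralGroup

theorem mem_closure_sr_iff {n : ℕ} (i : ZMod n) (x : DihedralGroup n) :
    x ∈ Subgroup.closure {sr i} ↔ x = 1 ∨ x = sr i := by
  constructor
  · intro hx
    induction hx using Subgroup.closure_induction with
    | mem y hy => exact Or.inr hy
    | one => exact Or.inl rfl
    | mul y z _ _ hy hz =>
      rcases hy with rfl | rfl <;> rcases hz with rfl | rfl <;> simp
    | inv y _ hy => rcases hy with rfl | rfl <;> simp
  · rintro (rfl | rfl)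
    · exact one_mem _
    · exact Subgroup.subset_closure rfl

theorem mem_closure_r_two_sr_zero_iff (x : DihedralGroup 6) :
    x ∈ Subgroup.closure {r (2 : ZMod 6), sr (0 : ZMod 6)} ↔
      x ∈ ({r 0, r 2, r 4, sr 0, sr 2, sr 4} : Finset (DihedralGroup 6)) := by
  constructor
  · intro hx
    induction hx using Subgroup.closure_induction with
    | mem y hy => rcases hy with rfl | rfl <;> decide
    | one => decide
    | mul y z hy' hz' hy hz => clear hy' hz'; revert y z; decide
    | inv y hy' hy => clear hy'; revert y; decide
  · intro hx
    have hr : r (2 : ZMod 6) ∈ Subgroup.closure {r (2 : ZMod 6), sr (0 : ZMod 6)} :=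
      Subgroup.subset_closure (by simp)
    have hs : sr (0 : ZMod 6) ∈ Subgroup.closure {r (2 : ZMod 6), sr (0 : ZMod 6)} :=
      Subgroup.subset_closure (by simp)
    have key : ∀ y ∈ ({r 0, r 2, r 4, sr 0, sr 2, sr 4} : Finset (DihedralGroup 6)),
        ∃ i : Fin 2, ∃ j : Fin 3, y = sr 0 ^ (i : ℕ) * r 2 ^ (j : ℕ) := by decide
    obtain ⟨i, j, rfl⟩ := key x hx
    exact mul_mem (pow_mem hs _) (pow_mem hr _)

theorem normal_closure_r_two_sr_zero :
    (Subgroup.closure {r (2 : ZMod 6), sr (0 : ZMod 6)}).Normal := by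
  refine ⟨fun x hx g => ?_⟩
  rw [mem_closure_r_two_sr_zero_iff] at hx ⊢
  revert x g
  decide

theorem closure_sr_zero_le :
    Subgroup.closure {sr (0 : ZMod 6)} ≤
      Subgroup.closure {r (2 : ZMod 6), sr (0 : ZMod 6)} :=
  Subgroup.closure_mono (by simp)

theorem sqn4In_closure_sr_zero :
    Sqn4In (Subgroup.closure {sr (0 : ZMod 6)})
      (Subgroup.closure {r (2 : ZMod 6), sr (0 : ZMod 6)}) := by
  refine fun L hL => perm4_of_forall_mem fun x hx => ?_
  by_cases h : L ≤ Subgroup.closure {sr (0 : ZMod 6)}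
  · rw [sup_eq_left.2 h] at hx
    exact ⟨x, hx, 1, one_mem _, 1, one_mem _, 1, one_mem _, by simp⟩
  · obtain ⟨l, hl, hl'⟩ := SetLike.not_le_iff_exists.1 h
    have key : ∀ l ∈ ({r 0, r 2, r 4, sr 0, sr 2, sr 4} : Finset (DihedralGroup 6)),
        ¬ (l = 1 ∨ l = sr 0) →
        ∀ x ∈ ({r 0, r 2, r 4, sr 0, sr 2, sr 4} : Finset (DihedralGroup 6)),
        ∃ i j k m : Fin 2,
          sr 0 ^ (i : ℕ) * l ^ (j : ℕ) * sr 0 ^ (k : ℕ) * l ^ (m : ℕ) = x := by decide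
    obtain ⟨i, j, k, m, e⟩ := key l ((mem_closure_r_two_sr_zero_iff l).1 (hL hl))
      (mt (mem_closure_sr_iff 0 l).2 hl') x
      ((mem_closure_r_two_sr_zero_iff x).1 (sup_le closure_sr_zero_le hL hx))
    have hs : sr (0 : ZMod 6) ∈ Subgroup.closure {sr (0 : ZMod 6)} :=
      Subgroup.subset_closure rfl
    exact ⟨_, pow_mem hs _, _, pow_mem hl _, _, pow_mem hs _, _, pow_mem hl _, e⟩

theorem not_sqn4_closure_sr_zero : ¬ Sqn4 (Subgroup.closure {sr (0 : ZMod 6)}) := by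
  intro h
  have hs : sr (0 : ZMod 6) ∈
      Subgroup.closure {sr (0 : ZMod 6)} ⊔ Subgroup.closure {sr (1 : ZMod 6)} :=
    Subgroup.mem_sup_left (Subgroup.subset_closure rfl)
  have ht : sr (1 : ZMod 6) ∈
      Subgroup.closure {sr (0 : ZMod 6)} ⊔ Subgroup.closure {sr (1 : ZMod 6)} :=
    Subgroup.mem_sup_right (Subgroup.subset_closure rfl)
  have hmem : (sr 0 * sr 1) ^ 3 ∈ ((Subgroup.closure {sr (0 : ZMod 6)} ⊔
      Subgroup.closure {sr (1 : ZMod 6)} : Subgroup _) : Set (DihedralGroup 6)) :=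
    pow_mem (mul_mem hs ht) 3
  rw [h (Subgroup.closure {sr 1})] at hmem
  obtain ⟨_, ⟨_, ⟨a, ha, b, hb, rfl⟩, c, hc, rfl⟩, d, hd, e⟩ := hmem
  rw [SetLike.mem_coe, mem_closure_sr_iff] at ha hb hc hd
  rcases ha with rfl | rfl <;> rcases hb with rfl | rfl <;>
    rcases hc with rfl | rfl <;> rcases hd with rfl | rfl <;> revert e <;> decide

end DihedralGroup

/-- `D₁₂` is not an Sq4T-group: `⟨s⟩` is strongly 4-quasinormal in `H = ⟨r², s⟩` and
`H` is strongly 4-quasinormal in `D₁₂`, but `⟨s⟩` is not strongly 4-quasinormal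
in `D₁₂`. -/
theorem D12_not_isSq4T :
    Subgroup.closure {DihedralGroup.sr (0 : ZMod 6)} ≤
      Subgroup.closure {DihedralGroup.r (2 : ZMod 6), DihedralGroup.sr (0 : ZMod 6)} ∧
    Sqn4In (Subgroup.closure {DihedralGroup.sr (0 : ZMod 6)})
      (Subgroup.closure {DihedralGroup.r (2 : ZMod 6), DihedralGroup.sr (0 : ZMod 6)}) ∧
    Sqn4 (Subgroup.closure {DihedralGroup.r (2 : ZMod 6), DihedralGroup.sr (0 : ZMod 6)}) ∧
    ¬ Sqn4 (Subgroup.closure {DihedralGroup.sr (0 : ZMod 6)}) ∧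
    ¬ IsSq4T (DihedralGroup 6) := by
  have hIn := DihedralGroup.sqn4In_closure_sr_zero
  have hN := DihedralGroup.normal_closure_r_two_sr_zero
  have hle := DihedralGroup.closure_sr_zero_le
  have hnot := DihedralGroup.not_sqn4_closure_sr_zero
  have hsq := sqn4_of_normal (Subgroup.closure {DihedralGroup.r (2 : ZMod 6), DihedralGroup.sr 0})
  exact ⟨hle, hIn, hsq, hnot, fun h => hnot (h _ _ hle hIn hsq)⟩
end

section
/- Every subgroup of the dihedral group D₈ = ⟨r, s : r⁴ = s² = 1, s r s = r⁻¹⟩ of order 8 is strongly 4-quasinormal in D₈; consequently, D₈ is an Sq4T-group. -/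
open scoped Pointwise

/-- If `KHKH ⊆ HKHK`, then `HKHK` is the subgroup generated by `H` and `K`. -/
theorem perm4_of_mul_subset {G : Type*} [Group G] {H K : Subgroup G}
    (h : (K : Set G) * H * K * H ⊆ (H : Set G) * K * H * K) : Perm4 H K := by
  have hmul : ((H : Set G) * K * H * K) * ((H : Set G) * K * H * K) ⊆ (H : Set G) * K * H * K :=
    calc ((H : Set G) * K * H * K) * ((H : Set G) * K * H * K)
        = H * (K * H * K * H) * (K * H * K) := by simp only [mul_assoc]
      _ ⊆ H * (H * K * H * K) * (K * H * K) := by gcongr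
      _ = (H * H) * K * H * (K * K) * H * K := by simp only [mul_assoc]
      _ = H * (K * H * K * H) * K := by simp only [coe_mul_coe, mul_assoc]
      _ ⊆ H * (H * K * H * K) * K := by gcongr
      _ = (H * H) * K * H * (K * K) := by simp only [mul_assoc]
      _ = H * K * H * K := by simp only [coe_mul_coe]
  let S : Subgroup G :=
    { carrier := (H : Set G) * K * H * K
      one_mem' := ⟨1, ⟨1, ⟨1, H.one_mem, 1, K.one_mem, by simp⟩, 1, H.one_mem, by simp⟩,
        1, K.one_mem, by simp⟩
      mul_mem' := fun ha hb => hmul (Set.mul_mem_mul ha hb)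
      inv_mem' := by
        rintro _ ⟨_, ⟨_, ⟨a, ha, b, hb, rfl⟩, c, hc, rfl⟩, d, hd, rfl⟩
        refine h ⟨_, ⟨_, ⟨d⁻¹, K.inv_mem hd, c⁻¹, H.inv_mem hc, rfl⟩, b⁻¹, K.inv_mem hb, rfl⟩,
          a⁻¹, H.inv_mem ha, ?_⟩
        simp [mul_assoc] }
  refine Set.Subset.antisymm ?_ ?_
  · have hS : H ⊔ K ≤ S := sup_le
      (fun a ha => ⟨a, ⟨a, ⟨a, ha, 1, K.one_mem, by simp⟩, 1, H.one_mem, by simp⟩,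
        1, K.one_mem, by simp⟩)
      (fun b hb => ⟨1, ⟨1, ⟨1, H.one_mem, 1, K.one_mem, by simp⟩, 1, H.one_mem, by simp⟩,
        b, hb, by simp⟩)
    exact hS
  · rintro _ ⟨_, ⟨_, ⟨a, ha, b, hb, rfl⟩, c, hc, rfl⟩, d, hd, rfl⟩
    have hH : H ≤ H ⊔ K := le_sup_left
    have hK : K ≤ H ⊔ K := le_sup_right
    exact mul_mem (mul_mem (mul_mem (hH ha) (hK hb)) (hH hc)) (hK hd)

/-- All commutators in the dihedral group of order 8 lie in its centre, which has order 2; hence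
a word `khlm` can be rearranged using at most one commutator. -/
theorem DihedralGroup.four_word_rearrange : ∀ k h l m : DihedralGroup 4,
    k * h * l * m = h * m * (k * l) ∨
    k * h * l * m = h * m * h * k * h⁻¹ * l ∨
    k * h * l * m = h * m * m * (k * l) * m⁻¹ := by
  decide +kernel

theorem DihedralGroup.sqn4_four (H : Subgroup (DihedralGroup 4)) : Sqn4 H := by
  intro K
  apply perm4_of_mul_subset
  rintro _ ⟨_, ⟨_, ⟨k, hk, h, hh, rfl⟩, l, hl, rfl⟩, m, hm, rfl⟩
  rcases four_word_rearrange k h l m with e | e | e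
  · exact ⟨_, ⟨_, ⟨h * m, mul_mem hh hm, k * l, mul_mem hk hl, rfl⟩, 1, H.one_mem, rfl⟩,
      1, K.one_mem, by simp [e]⟩
  · exact ⟨_, ⟨_, ⟨h * m * h, mul_mem (mul_mem hh hm) hh, k, hk, rfl⟩, h⁻¹, H.inv_mem hh, rfl⟩,
      l, hl, e.symm⟩
  · exact ⟨_, ⟨_, ⟨h * m * m, mul_mem (mul_mem hh hm) hm, k * l, mul_mem hk hl, rfl⟩,
      m⁻¹, H.inv_mem hm, rfl⟩, 1, K.one_mem, by simp [e]⟩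

/-- Every subgroup of the dihedral group of order 8 is strongly 4-quasinormal in it;
consequently, it is an Sq4T-group. -/
theorem D8_isSq4T :
    (∀ H : Subgroup (DihedralGroup 4), Sqn4 H) ∧ IsSq4T (DihedralGroup 4) :=
  ⟨DihedralGroup.sqn4_four, fun H _ _ _ _ => DihedralGroup.sqn4_four H⟩
end

section
/- Every subgroup of the alternating group A₄ is strongly 4-quasinormal in A₄. -/
open scoped Pointwise

/-- If `k` conjugates no nontrivial element of `P` into `P` and `|G| = |P| + |P|²`, then `G` is the
union of `P` and the double coset `PkP`. -/
theorem mem_or_exists_eq_mul_mul_of_card {G : Type*} [Group G] [Finite G] {P : Subgroup G} {k : G}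
    (hcard : Nat.card G = Nat.card P + Nat.card P * Nat.card P)
    (hk : ∀ x ∈ P, k * x * k⁻¹ ∈ P → x = 1) (hkP : k ∉ P) (g : G) :
    g ∈ P ∨ ∃ a ∈ P, ∃ b ∈ P, g = a * k * b := by
  let f : P ⊕ P × P → G := Sum.elim (fun a => a) fun p => p.1 * k * p.2
  have hne (x a b : P) : (x : G) ≠ a * k * b := fun h => hkP <| by
    have : k = (a : G)⁻¹ * x * (b : G)⁻¹ := by rw [h]; group
    rw [this]
    exact mul_mem (mul_mem (inv_mem a.2) x.2) (inv_mem b.2)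
  have hf : Function.Injective f := by
    refine Function.Injective.sumElim Subtype.coe_injective ?_ fun x p => hne x p.1 p.2
    rintro ⟨a, b⟩ ⟨c, d⟩ (h : (a : G) * k * b = c * k * d)
    have hconj : k * (b * (d : G)⁻¹) * k⁻¹ = (a : G)⁻¹ * c := by
      calc k * (b * (d : G)⁻¹) * k⁻¹ = (a : G)⁻¹ * (a * k * b) * (d : G)⁻¹ * k⁻¹ := by group
        _ = (a : G)⁻¹ * c := by rw [h]; group
    have hbd : b = d := Subtype.ext <| mul_inv_eq_one.1 <|
      hk _ (mul_mem b.2 (inv_mem d.2)) (hconj ▸ mul_mem (inv_mem a.2) c.2)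
    subst hbd
    rw [mul_left_inj, mul_left_inj] at h
    rw [Subtype.ext h]
  have hsurj := (hf.bijective_of_nat_card_le
    (by rw [hcard, Nat.card_sum, Nat.card_prod])).surjective g
  obtain ⟨x | ⟨a, b⟩, rfl⟩ := hsurj
  · exact Or.inl x.2
  · exact Or.inr ⟨a, a.2, b, b.2, rfl⟩

/-- Of two non-commuting elements of `A₄`, one has order `3` and the other one does not normalize the
subgroup it generates. -/
theorem alternatingGroup_four_commute_or (h k : alternatingGroup (Fin 4)) :
    h * k = k * h ∨
      (h ^ 3 = 1 ∧ ∀ a b : Fin 3, k * h ^ (a : ℕ) = h ^ (b : ℕ) * k → a = 0) ∨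
      (k ^ 3 = 1 ∧ ∀ a b : Fin 3, h * k ^ (a : ℕ) = k ^ (b : ℕ) * h → a = 0) := by
  revert h k
  decide +kernel

/-- If `h` has order `3` in `A₄` and `k` does not normalize `⟨h⟩`, then `A₄ = ⟨h⟩ ∪ ⟨h⟩k⟨h⟩`. -/
theorem alternatingGroup_four_mem_zpowers_or {h k : alternatingGroup (Fin 4)}
    (hne : h * k ≠ k * h) (h3 : h ^ 3 = 1)
    (hk : ∀ a b : Fin 3, k * h ^ (a : ℕ) = h ^ (b : ℕ) * k → a = 0) (g : alternatingGroup (Fin 4)) :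
    g ∈ Subgroup.zpowers h ∨
      ∃ a ∈ Subgroup.zpowers h, ∃ b ∈ Subgroup.zpowers h, g = a * k * b := by
  have h1 : h ≠ 1 := by
    rintro rfl
    simp at hne
  have hord : orderOf h = 3 := orderOf_eq_prime h3 h1
  have hpow {x} (hx : x ∈ Subgroup.zpowers h) : ∃ a : Fin 3, h ^ (a : ℕ) = x := by
    classical
    rw [mem_zpowers_iff_mem_range_orderOf, hord] at hx
    obtain ⟨a, ha, rfl⟩ := Finset.mem_image.1 hx
    exact ⟨⟨a, Finset.mem_range.1 ha⟩, rfl⟩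
  refine mem_or_exists_eq_mul_mul_of_card ?_ (fun x hx hy => ?_) (fun hmem => ?_) g
  · rw [Nat.card_zpowers, hord, nat_card_alternatingGroup, Nat.card_fin]
    rfl
  · obtain ⟨a, rfl⟩ := hpow hx
    obtain ⟨b, hb⟩ := hpow hy
    rw [hk a b (by rw [hb, inv_mul_cancel_right])]
    rfl
  · obtain ⟨n, rfl⟩ := Subgroup.mem_zpowers_iff.1 hmem
    exact hne (Commute.self_zpow h n)

/-- Subgroups that commute elementwise are 4-permutable. -/
theorem perm4_of_forall_commute {G : Type*} [Group G] {H K : Subgroup G}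
    (hHK : ∀ h ∈ H, ∀ k ∈ K, h * k = k * h) : Perm4 H K := by
  have hle : H ≤ Subgroup.normalizer (K : Set G) := fun h hh =>
    Subgroup.centralizer_le_normalizer _ (Subgroup.mem_centralizer_iff.2 fun k hk =>
      (hHK h hh k hk).symm)
  rw [Perm4, mul_assoc _ (H : Set G), ← Subgroup.coe_mul_of_left_le_normalizer_right H K hle,
    coe_mul_coe]

/-- Every subgroup of the alternating group `A₄` is strongly 4-quasinormal in `A₄`. -/
theorem sqn4_all_subgroups_A4 (H : Subgroup (alternatingGroup (Fin 4))) : Sqn4 H := by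
  intro K
  by_cases hHK : ∀ h ∈ H, ∀ k ∈ K, h * k = k * h
  · exact perm4_of_forall_commute hHK
  · push Not at hHK
    obtain ⟨h, hh, k, hk, hne⟩ := hHK
    have huniv : (H : Set (alternatingGroup (Fin 4))) * (K : Set _) * (H : Set _) * (K : Set _) =
        Set.univ := by
      refine Set.eq_univ_of_forall fun g => ?_
      rcases (alternatingGroup_four_commute_or h k).resolve_left hne with ⟨h3, hk3⟩ | ⟨k3, hh3⟩
      · have hle : Subgroup.zpowers h ≤ H := Subgroup.zpowers_le.2 hh
        rcases alternatingGroup_four_mem_zpowers_or hne h3 hk3 g with hg | ⟨a, ha, b, hb, rfl⟩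
        · exact ⟨g, ⟨g, ⟨g, hle hg, 1, K.one_mem, mul_one g⟩, 1, H.one_mem, mul_one g⟩,
            1, K.one_mem, mul_one g⟩
        · exact ⟨_, Set.mul_mem_mul (Set.mul_mem_mul (hle ha) hk) (hle hb), 1, K.one_mem,
            mul_one _⟩
      · have hle : Subgroup.zpowers k ≤ K := Subgroup.zpowers_le.2 hk
        rcases alternatingGroup_four_mem_zpowers_or hne.symm k3 hh3 g with hg | ⟨a, ha, b, hb, rfl⟩
        · exact ⟨1, ⟨1, ⟨1, H.one_mem, 1, K.one_mem, mul_one 1⟩, 1, H.one_mem, mul_one 1⟩,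
            g, hle hg, one_mul g⟩
        · exact Set.mul_mem_mul (Set.mul_mem_mul ⟨1, H.one_mem, a, hle ha, one_mul a⟩ hh) (hle hb)
    refine Set.Subset.antisymm (huniv ▸ Set.subset_univ _) ?_
    rintro _ ⟨_, ⟨_, ⟨a, ha, b, hb, rfl⟩, c, hc, rfl⟩, d, hd, rfl⟩
    exact mul_mem (mul_mem (mul_mem (Subgroup.mem_sup_left ha) (Subgroup.mem_sup_right hb))
      (Subgroup.mem_sup_left hc)) (Subgroup.mem_sup_right hd)
end

section
/- The alternating group A₄ is an Sq4T-group that is not supersolvable. -/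
open scoped Pointwise

/-- A group is supersolvable if it has a normal series (all terms normal in the whole
group) whose successive factors are cyclic; the factor `f i.succ / f i.castSucc` being
cyclic is expressed by `f i.succ` being generated by `f i.castSucc` together with a
single element. -/
def IsSupersolvable (G : Type*) [Group G] : Prop :=
  ∃ (n : ℕ) (f : Fin (n + 1) → Subgroup G),
    f 0 = ⊥ ∧ f (Fin.last n) = ⊤ ∧
    (∀ i, (f i).Normal) ∧
    (∀ i : Fin n, f i.castSucc ≤ f i.succ) ∧
    (∀ i : Fin n, ∃ x ∈ f i.succ, f i.succ = f i.castSucc ⊔ Subgroup.zpowers x)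

namespace AlternatingGroupFour

theorem sq_or_cube_eq_one (g : alternatingGroup (Fin 4)) : g ^ 2 = 1 ∨ g ^ 3 = 1 := by
  revert g; decide +kernel

theorem commutator_sq (a b : alternatingGroup (Fin 4)) : (a * b * a⁻¹ * b⁻¹) ^ 2 = 1 := by
  revert a b; decide +kernel

/-- Unless one of `x`, `y` is trivial or `y = x` or `y = x⁻¹`, every involution of `A₄` is one of
finitely many short words in `x` and `y`. -/
theorem involution_mem_words (x y v : alternatingGroup (Fin 4)) (hv : v ^ 2 = 1) :
    x = 1 ∨ y = 1 ∨ y = x ∨ y = x⁻¹ ∨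
      v ∈ [1, x, y, x * y, y * x, x * y⁻¹, y⁻¹ * x, x * x * y * x⁻¹, x * x * y⁻¹ * x⁻¹,
        x * y * x⁻¹, x⁻¹ * y * x, y * x * y⁻¹, y⁻¹ * x * y] := by
  revert x y v; decide +kernel

theorem exists_conj_ne (x : alternatingGroup (Fin 4)) (hx : x ≠ 1) :
    ∃ g, g * x * g⁻¹ ≠ 1 ∧ g * x * g⁻¹ ≠ x ∧ g * x * g⁻¹ ≠ x ^ 2 := by
  revert x; decide +kernel

theorem eq_one_or_eq_or_eq_inv (H : Subgroup (alternatingGroup (Fin 4)))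
    (hH : ¬ ∀ v : alternatingGroup (Fin 4), v ^ 2 = 1 → v ∈ H)
    {x y : alternatingGroup (Fin 4)} (hx : x ∈ H) (hy : y ∈ H) :
    x = 1 ∨ y = 1 ∨ y = x ∨ y = x⁻¹ := by
  by_contra! hne
  refine hH fun v hv => ?_
  have hx' := H.inv_mem hx
  have hy' := H.inv_mem hy
  have hmem := involution_mem_words x y v hv
  simp only [hne, false_or, List.mem_cons, List.not_mem_nil, or_false] at hmem
  rcases hmem with rfl | rfl | rfl | rfl | rfl | rfl | rfl | rfl | rfl | rfl | rfl | rfl | rfl <;>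
    first
    | exact H.one_mem
    | assumption
    | (apply_rules [H.mul_mem])

theorem conj_mem_of_involutions_mem {H : Subgroup (alternatingGroup (Fin 4))}
    (hH : ∀ v : alternatingGroup (Fin 4), v ^ 2 = 1 → v ∈ H)
    (g : alternatingGroup (Fin 4)) {x : alternatingGroup (Fin 4)} (hx : x ∈ H) :
    g * x * g⁻¹ ∈ H := by
  simpa using H.mul_mem (hH _ (commutator_sq g x)) hx

theorem mem_mul_of_eq {H K : Subgroup (alternatingGroup (Fin 4))}
    {g a b c d : alternatingGroup (Fin 4)} (ha : a ∈ H) (hb : b ∈ K) (hc : c ∈ H) (hd : d ∈ K)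
    (hg : g = a * b * c * d) : g ∈ (H : Set (alternatingGroup (Fin 4))) * K * H * K :=
  hg ▸ Set.mul_mem_mul (Set.mul_mem_mul (Set.mul_mem_mul ha hb) hc) hd

theorem mul_mem_mul_swap (H K : Subgroup (alternatingGroup (Fin 4)))
    {k h k' h' : alternatingGroup (Fin 4)} (hk : k ∈ K) (hh : h ∈ H) (hk' : k' ∈ K)
    (hh' : h' ∈ H) :
    k * h * k' * h' ∈ (H : Set (alternatingGroup (Fin 4))) * K * H * K := by
  by_cases hVH : ∀ v : alternatingGroup (Fin 4), v ^ 2 = 1 → v ∈ H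
  · exact mem_mul_of_eq (conj_mem_of_involutions_mem hVH k hh) (K.mul_mem hk hk') hh' K.one_mem
      (by group)
  by_cases hVK : ∀ v : alternatingGroup (Fin 4), v ^ 2 = 1 → v ∈ K
  · exact mem_mul_of_eq (H.mul_mem hh hh')
      (K.mul_mem (conj_mem_of_involutions_mem hVK (h * h')⁻¹ hk)
        (conj_mem_of_involutions_mem hVK h'⁻¹ hk')) H.one_mem K.one_mem (by group)
  rcases eq_one_or_eq_or_eq_inv K hVK hk hk' with rfl | rfl | hkk
  · exact mem_mul_of_eq hh hk' hh' K.one_mem (by group)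
  · exact mem_mul_of_eq H.one_mem hk (H.mul_mem hh hh') K.one_mem (by group)
  rcases eq_one_or_eq_or_eq_inv H hVH hh hh' with rfl | rfl | hhh
  · exact mem_mul_of_eq H.one_mem (K.mul_mem hk hk') hh' K.one_mem (by group)
  · exact mem_mul_of_eq H.one_mem hk hh hk' (by group)
  have hh_inv := H.inv_mem hh
  have hk_inv := K.inv_mem hk
  rcases hkk with rfl | rfl
  · rcases sq_or_cube_eq_one (k' * h) with hsq | hcube
    · have hkh : k' * h * k' = h⁻¹ := eq_inv_of_mul_eq_one_left
        (by rw [← hsq]; simp only [pow_succ, pow_zero]; group)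
      exact mem_mul_of_eq (H.mul_mem hh_inv hh') K.one_mem H.one_mem K.one_mem
        (by rw [hkh]; group)
    · have hkh : k' * h * k' = h⁻¹ * k'⁻¹ * h⁻¹ := by
        have : k' * h * k' * (h * k' * h) = 1 := by
          rw [← hcube]; simp only [pow_succ, pow_zero]; group
        rw [eq_inv_of_mul_eq_one_left this]; group
      exact mem_mul_of_eq hh_inv hk_inv (H.mul_mem hh_inv hh') K.one_mem (by rw [hkh]; group)
  · rcases hhh with rfl | rfl
    · rcases sq_or_cube_eq_one (h' * k⁻¹) with hsq | hcube
      · have hhk : h' * k⁻¹ * h' = k := by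
          rw [← inv_inv k]
          exact eq_inv_of_mul_eq_one_left
            (by rw [inv_inv, ← hsq]; simp only [pow_succ, pow_zero]; group)
        exact mem_mul_of_eq H.one_mem (K.mul_mem hk hk) H.one_mem K.one_mem
          (by rw [mul_assoc k, mul_assoc k, hhk]; group)
      · have hhk : h' * k⁻¹ * h' = k * h'⁻¹ * k := by
          have : h' * k⁻¹ * h' * (k⁻¹ * h' * k⁻¹) = 1 := by
            rw [← hcube]; simp only [pow_succ, pow_zero]; group
          rw [eq_inv_of_mul_eq_one_left this]; group
        exact mem_mul_of_eq H.one_mem (K.mul_mem hk hk) hh_inv hk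
          (by rw [mul_assoc k, mul_assoc k, hhk]; group)
    · have hcomm := commutator_sq k h
      rw [pow_two] at hcomm
      exact mem_mul_of_eq hh hk hh_inv hk_inv
        ((eq_inv_of_mul_eq_one_left hcomm).trans (by group))

theorem mul_mem_of_mem_union {H K : Subgroup (alternatingGroup (Fin 4))}
    {g y : alternatingGroup (Fin 4)} (hg : g ∈ (H : Set (alternatingGroup (Fin 4))) * K * H * K)
    (hy : y ∈ (H : Set (alternatingGroup (Fin 4))) ∪ K) :
    g * y ∈ (H : Set (alternatingGroup (Fin 4))) * K * H * K := by
  obtain ⟨_, ⟨_, ⟨a, ha, b, hb, rfl⟩, c, hc, rfl⟩, d, hd, rfl⟩ := hg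
  rcases hy with hy | hy
  · obtain ⟨_, ⟨_, ⟨p, hp, q, hq, rfl⟩, r, hr, rfl⟩, t, ht, hpqrt⟩ :=
      mul_mem_mul_swap H K hb hc hd hy
    refine mem_mul_of_eq (H.mul_mem ha hp) hq hr ht ?_
    calc a * b * c * d * y = a * (b * c * d * y) := by group
      _ = a * (p * q * r * t) := by rw [← hpqrt]
      _ = a * p * q * r * t := by group
  · exact mem_mul_of_eq ha hb hc (K.mul_mem hd hy) (mul_assoc _ _ _)

theorem perm4 (H K : Subgroup (alternatingGroup (Fin 4))) : Perm4 H K := by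
  apply Set.Subset.antisymm
  · intro g hg
    rw [Subgroup.sup_eq_closure] at hg
    induction hg using Subgroup.closure_induction_right with
    | one => exact mem_mul_of_eq H.one_mem K.one_mem H.one_mem K.one_mem (by group)
    | mul_right x _ y hy hx => exact mul_mem_of_mem_union hx hy
    | mul_inv_cancel x _ y hy hx =>
      exact mul_mem_of_mem_union hx (hy.imp H.inv_mem K.inv_mem)
  · rintro _ ⟨_, ⟨_, ⟨a, ha, b, hb, rfl⟩, c, hc, rfl⟩, d, hd, rfl⟩
    have hHle : H ≤ H ⊔ K := le_sup_left
    have hKle : K ≤ H ⊔ K := le_sup_right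
    exact mul_mem (mul_mem (mul_mem (hHle ha) (hKle hb)) (hHle hc)) (hKle hd)

theorem eq_one_of_normal_zpowers (x : alternatingGroup (Fin 4))
    (hn : (Subgroup.zpowers x).Normal) : x = 1 := by
  by_contra hx
  obtain ⟨g, h0, h1, h2⟩ := exists_conj_ne x hx
  obtain ⟨n, hn⟩ := mem_powers_iff_mem_zpowers.mpr
    (hn.conj_mem x (Subgroup.mem_zpowers x) g)
  have hn : x ^ n = g * x * g⁻¹ := hn
  have hx3 : x ^ n = 1 ∨ x ^ n = x ∨ x ^ n = x ^ 2 := by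
    rcases sq_or_cube_eq_one x with h | h
    · rw [pow_eq_pow_mod n h]
      have := Nat.mod_lt n (show 0 < 2 by norm_num)
      interval_cases n % 2 <;> simp
    · rw [pow_eq_pow_mod n h]
      have := Nat.mod_lt n (show 0 < 3 by norm_num)
      interval_cases n % 3 <;> simp
  rw [hn] at hx3
  tauto

end AlternatingGroupFour

/-- The alternating group `A₄` is an Sq4T-group that is not supersolvable. -/
theorem A4_isSq4T_not_supersolvable :
    IsSq4T (alternatingGroup (Fin 4)) ∧ ¬ IsSupersolvable (alternatingGroup (Fin 4)) := by
  refine ⟨fun H _ _ _ _ K => AlternatingGroupFour.perm4 H K, ?_⟩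
  rintro ⟨n, f, h0, hlast, hnormal, -, hcyc⟩
  have hbot : ∀ i, f i = ⊥ := by
    intro i
    induction i using Fin.induction with
    | zero => exact h0
    | succ i ih =>
      obtain ⟨x, -, hx⟩ := hcyc i
      rw [ih, bot_sup_eq] at hx
      have hn := hnormal i.succ
      rw [hx] at hn ⊢
      rw [AlternatingGroupFour.eq_one_of_normal_zpowers x hn, Subgroup.zpowers_one_eq_bot]
  have : (⊥ : Subgroup (alternatingGroup (Fin 4))) = ⊤ := (hbot _).symm.trans hlast
  exact bot_ne_top this
end

section
/- If K₁ and K₂ are two distinct subgroups of order 3 of the alternating group A₄, then the set product K₁K₂K₁K₂ equals all of A₄ (which equals ⟨K₁, K₂⟩), and the commutator subgroup [K₁, K₂] equals the Klein four subgroup V = ⟨(1 2)(3 4), (1 3)(2 4)⟩. -/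
open scoped commutatorElement

open scoped Pointwise

theorem disjoint_of_card_eq_prime {G : Type*} [Group G] {H K : Subgroup G} {p : ℕ}
    (hp : p.Prime) (hH : Nat.card H = p) (hK : Nat.card K = p) (hne : H ≠ K) :
    Disjoint H K := by
  have : Finite H := Nat.finite_of_card_ne_zero (hH ▸ hp.ne_zero)
  have : Finite K := Nat.finite_of_card_ne_zero (hK ▸ hp.ne_zero)
  have hdvd : Nat.card (H ⊓ K : Subgroup G) ∣ p := hH ▸ Subgroup.card_dvd_of_le inf_le_left
  rw [disjoint_iff]
  rcases (Nat.dvd_prime hp).1 hdvd with h | h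
  · exact Subgroup.card_eq_one.1 h
  · have h₁ : H ⊓ K = H := Subgroup.eq_of_le_of_card_ge inf_le_left (by rw [h, hH])
    have h₂ : H ⊓ K = K := Subgroup.eq_of_le_of_card_ge inf_le_right (by rw [h, hK])
    exact absurd (h₁.symm.trans h₂) hne

/-- A subset of a finite subgroup `L` with more than half the elements of `L` has square `L`. -/
theorem mul_self_eq_of_card_lt {G : Type*} [Group G] {L : Subgroup G} [Finite L] {S : Set G}
    (hS : S ⊆ L) (hcard : Nat.card L < 2 * S.ncard) : S * S = (L : Set G) := by
  refine Set.Subset.antisymm ?_ fun g hg ↦ ?_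
  · rintro _ ⟨x, hx, y, hy, rfl⟩
    exact mul_mem (hS hx) (hS hy)
  · have hT : (fun x ↦ g * x⁻¹) '' S ⊆ L := by
      rintro _ ⟨x, hx, rfl⟩
      exact mul_mem hg (inv_mem (hS hx))
    have hTcard : ((fun x ↦ g * x⁻¹) '' S).ncard = S.ncard :=
      Set.ncard_image_of_injective S fun x y h ↦ inv_injective (mul_left_cancel h)
    have hL : (L : Set G).Finite := Set.toFinite _
    by_contra hmem
    have hdisj : Disjoint S ((fun x ↦ g * x⁻¹) '' S) := by
      rw [Set.disjoint_left]
      rintro _ hx ⟨y, hy, rfl⟩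
      exact hmem ⟨_, hx, y, hy, by simp⟩
    have hle := Set.ncard_le_ncard (Set.union_subset hS hT) hL
    rw [Set.ncard_union_eq hdisj (hL.subset hS) (hL.subset hT), hTcard,
      ← Nat.card_coe_set_eq (L : Set G)] at hle
    simp only [SetLike.coe_sort_coe] at hle
    omega

theorem ncard_mul_of_disjoint {G : Type*} [Group G] {H K : Subgroup G} (h : Disjoint H K) :
    ((H : Set G) * (K : Set G)).ncard = Nat.card H * Nat.card K := by
  have hrange : (H : Set G) * (K : Set G) = Set.range fun g : H × K ↦ (g.1 : G) * g.2 := by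
    ext x
    simp [Set.mem_mul]
  rw [hrange, ← Nat.card_coe_set_eq,
    Nat.card_range_of_injective (Subgroup.mul_injective_of_disjoint h), Nat.card_prod]

theorem mul_mul_mul_eq_alternatingGroup {K₁ K₂ : Subgroup (Equiv.Perm (Fin 4))}
    (hK₁ : K₁ ≤ alternatingGroup (Fin 4)) (hK₂ : K₂ ≤ alternatingGroup (Fin 4))
    (c₁ : Nat.card K₁ = 3) (c₂ : Nat.card K₂ = 3) (hd : Disjoint K₁ K₂) :
    (K₁ : Set (Equiv.Perm (Fin 4))) * (K₂ : Set (Equiv.Perm (Fin 4))) *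
        (K₁ : Set (Equiv.Perm (Fin 4))) * (K₂ : Set (Equiv.Perm (Fin 4))) =
      (alternatingGroup (Fin 4) : Set (Equiv.Perm (Fin 4))) := by
  rw [mul_assoc ((K₁ : Set (Equiv.Perm (Fin 4))) * K₂)]
  apply mul_self_eq_of_card_lt
  · rintro _ ⟨x, hx, y, hy, rfl⟩
    exact mul_mem (hK₁ hx) (hK₂ hy)
  · rw [ncard_mul_of_disjoint hd, c₁, c₂, nat_card_alternatingGroup, Nat.card_fin]
    decide

theorem exists_mem_pow_three_eq_one {G : Type*} [Group G] {K : Subgroup G}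
    (hK : Nat.card K = 3) : ∃ a ∈ K, a ^ 3 = 1 ∧ a ≠ 1 := by
  have hne : K ≠ ⊥ := by
    rintro rfl
    simp at hK
  obtain ⟨a, ha, ha1⟩ := K.ne_bot_iff_exists_ne_one.1 hne |>.imp fun a h ↦ And.intro a.2 h
  refine ⟨a, ha, ?_, by simpa using ha1⟩
  have := pow_card_eq_one' (x := a)
  rw [hK] at this
  exact_mod_cast congrArg Subtype.val this

theorem commutatorElement_eq_of_sign_eq_one :
    ∀ a b : Equiv.Perm (Fin 4), Equiv.Perm.sign a = 1 → Equiv.Perm.sign b = 1 →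
      ⁅a, b⁆ = 1 ∨
      ⁅a, b⁆ = Equiv.swap (0 : Fin 4) 1 * Equiv.swap (2 : Fin 4) 3 ∨
      ⁅a, b⁆ = Equiv.swap (0 : Fin 4) 2 * Equiv.swap (1 : Fin 4) 3 ∨
      ⁅a, b⁆ = Equiv.swap (0 : Fin 4) 1 * Equiv.swap (2 : Fin 4) 3 *
        (Equiv.swap (0 : Fin 4) 2 * Equiv.swap (1 : Fin 4) 3) := by
  decide +kernel

theorem eq_commutatorElement_of_pow_three_eq_one :
    ∀ a : Equiv.Perm (Fin 4), a ^ 3 = 1 → a ≠ 1 →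
      ∀ b : Equiv.Perm (Fin 4), b ^ 3 = 1 → b ≠ 1 → b ≠ a → b ≠ a⁻¹ →
      (Equiv.swap (0 : Fin 4) 1 * Equiv.swap (2 : Fin 4) 3 = ⁅a, b⁆ ∨
        Equiv.swap (0 : Fin 4) 1 * Equiv.swap (2 : Fin 4) 3 = ⁅a⁻¹, b⁆ ∨
        Equiv.swap (0 : Fin 4) 1 * Equiv.swap (2 : Fin 4) 3 = ⁅a, b⁻¹⁆ ∨
        Equiv.swap (0 : Fin 4) 1 * Equiv.swap (2 : Fin 4) 3 = ⁅a⁻¹, b⁻¹⁆) ∧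
      (Equiv.swap (0 : Fin 4) 2 * Equiv.swap (1 : Fin 4) 3 = ⁅a, b⁆ ∨
        Equiv.swap (0 : Fin 4) 2 * Equiv.swap (1 : Fin 4) 3 = ⁅a⁻¹, b⁆ ∨
        Equiv.swap (0 : Fin 4) 2 * Equiv.swap (1 : Fin 4) 3 = ⁅a, b⁻¹⁆ ∨
        Equiv.swap (0 : Fin 4) 2 * Equiv.swap (1 : Fin 4) 3 = ⁅a⁻¹, b⁻¹⁆) := by
  decide +kernel

theorem mem_closure_of_eq {G : Type*} [Group G] {x s t : G}
    (h : x = 1 ∨ x = s ∨ x = t ∨ x = s * t) : x ∈ Subgroup.closure {s, t} := by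
  have hs : s ∈ Subgroup.closure {s, t} := Subgroup.subset_closure (by simp)
  have ht : t ∈ Subgroup.closure {s, t} := Subgroup.subset_closure (by simp)
  rcases h with rfl | rfl | rfl | rfl
  exacts [one_mem _, hs, ht, mul_mem hs ht]

/-- If `K₁ ≠ K₂` are subgroups of order 3 of `A₄`, then `K₁K₂K₁K₂ = A₄ = ⟨K₁, K₂⟩`
and `[K₁, K₂]` is the Klein four subgroup `⟨(1 2)(3 4), (1 3)(2 4)⟩`. -/
theorem order_three_subgroups_A4 (K₁ K₂ : Subgroup (Equiv.Perm (Fin 4)))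
    (hK₁ : K₁ ≤ alternatingGroup (Fin 4)) (hK₂ : K₂ ≤ alternatingGroup (Fin 4))
    (c₁ : Nat.card K₁ = 3) (c₂ : Nat.card K₂ = 3) (hne : K₁ ≠ K₂) :
    (K₁ : Set (Equiv.Perm (Fin 4))) * (K₂ : Set (Equiv.Perm (Fin 4))) *
        (K₁ : Set (Equiv.Perm (Fin 4))) * (K₂ : Set (Equiv.Perm (Fin 4))) =
      (alternatingGroup (Fin 4) : Set (Equiv.Perm (Fin 4))) ∧
    K₁ ⊔ K₂ = alternatingGroup (Fin 4) ∧
    ⁅K₁, K₂⁆ = Subgroup.closure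
      {Equiv.swap (0 : Fin 4) 1 * Equiv.swap (2 : Fin 4) 3,
       Equiv.swap (0 : Fin 4) 2 * Equiv.swap (1 : Fin 4) 3} := by
  have hd : Disjoint K₁ K₂ := disjoint_of_card_eq_prime Nat.prime_three c₁ c₂ hne
  have hprod := mul_mul_mul_eq_alternatingGroup hK₁ hK₂ c₁ c₂ hd
  have hcomm : ⁅K₁, K₂⁆ ≤ Subgroup.closure
      {Equiv.swap (0 : Fin 4) 1 * Equiv.swap (2 : Fin 4) 3,
       Equiv.swap (0 : Fin 4) 2 * Equiv.swap (1 : Fin 4) 3} := by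
    refine Subgroup.commutator_le.2 fun a ha b hb ↦ ?_
    exact mem_closure_of_eq
      (commutatorElement_eq_of_sign_eq_one a b (hK₁ ha) (hK₂ hb))
  obtain ⟨a, ha, ha3, ha1⟩ := exists_mem_pow_three_eq_one c₁
  obtain ⟨b, hb, hb3, hb1⟩ := exists_mem_pow_three_eq_one c₂
  have hab : b ≠ a := fun h ↦ ha1 (Subgroup.disjoint_def.1 hd ha (h ▸ hb))
  have hab' : b ≠ a⁻¹ := fun h ↦ hb1 (Subgroup.disjoint_def.1 hd (h ▸ inv_mem ha) hb)
  have hgen := eq_commutatorElement_of_pow_three_eq_one a ha3 ha1 b hb3 hb1 hab hab'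
  have hmem : ∀ x, (x = ⁅a, b⁆ ∨ x = ⁅a⁻¹, b⁆ ∨ x = ⁅a, b⁻¹⁆ ∨ x = ⁅a⁻¹, b⁻¹⁆) →
      x ∈ ⁅K₁, K₂⁆ := by
    rintro x (rfl | rfl | rfl | rfl)
    · exact Subgroup.commutator_mem_commutator ha hb
    · exact Subgroup.commutator_mem_commutator (inv_mem ha) hb
    · exact Subgroup.commutator_mem_commutator ha (inv_mem hb)
    · exact Subgroup.commutator_mem_commutator (inv_mem ha) (inv_mem hb)
  refine ⟨hprod, le_antisymm (sup_le hK₁ hK₂) fun g hg ↦ ?_, le_antisymm hcomm ?_⟩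
  · rw [← SetLike.mem_coe, ← hprod] at hg
    obtain ⟨_, ⟨_, ⟨x, hx, y, hy, rfl⟩, z, hz, rfl⟩, w, hw, rfl⟩ := hg
    exact mul_mem (mul_mem (mul_mem (Subgroup.mem_sup_left hx) (Subgroup.mem_sup_right hy))
      (Subgroup.mem_sup_left hz)) (Subgroup.mem_sup_right hw)
  · rw [Subgroup.closure_le]
    rintro x (rfl | rfl)
    · exact hmem _ hgen.1
    · exact hmem _ hgen.2
end
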